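/- arXiv:1803.05542 — 7 statements merged into one kernel-verified Lean document; each statement's English description precedes it below -/
import Mathlib

section
/- Let E₁ and E₂ be finite-dimensional real normed vector spaces, let U₁ ⊆ E₁ and U₂ ⊆ E₂ be nonempty, compact (closed and bounded) convex sets, and let J₁, J₂ : E₁ × E₂ → ℝ be jointly continuous functions such that for every u₂ ∈ U₂ the map u₁ ↦ J₁(u₁, u₂) is strictly convex on U₁, and for every u₁ ∈ U₁ the map u₂ ↦ J₂(u₁, u₂) is strictly convex on U₂. Then there exists a pure-strategy Nash equilibrium, i.e., a pair (u₁*, u₂*) ∈ U₁ × U₂ such that J₁(u₁*, u₂*) ≤ J₁(u₁, u₂*) for all u₁ ∈ U₁ and J₂(u₁*, u₂*) ≤ J₂(u₁*, u₂) for all u₂ ∈ U₂. -/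
open Set Filter Topology MeasureTheory Metric Function
open scoped NNReal

/-- Minimizers of a continuous family of strictly convex functions on a compact set depend
continuously on the parameter. -/
theorem exists_continuous_minimizer {E X : Type*} [NormedAddCommGroup E] [NormedSpace ℝ E]
    [TopologicalSpace X] {U : Set E} (hne : U.Nonempty) (hU : IsCompact U) {J : E → X → ℝ}
    (hJ : Continuous fun p : E × X => J p.1 p.2)
    (hconv : ∀ x, StrictConvexOn ℝ U fun u => J u x) :
    ∃ b : X → E, Continuous b ∧ ∀ x, b x ∈ U ∧ ∀ v ∈ U, J (b x) x ≤ J v x := by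
  have hmin : ∀ x, ∃ u ∈ U, ∀ v ∈ U, J u x ≤ J v x := fun x =>
    hU.exists_isMinOn hne (hJ.comp (Continuous.prodMk_left x)).continuousOn
  choose b hbU hb using hmin
  refine ⟨b, continuous_iff_continuousAt.2 fun x => ?_, fun x => ⟨hbU x, hb x⟩⟩
  refine hU.le_nhds_of_unique_clusterPt (mem_map.2 (univ_mem' hbU)) fun y hy hcl => ?_
  refine (hconv x).eq_of_isMinOn (fun v hv => ?_) (fun v hv => hb x v hv) hy (hbU x)
  by_contra hlt
  simp only [mem_ofPred_eq, not_le] at hlt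
  have hcont : Continuous fun p : E × X => J v p.2 :=
    hJ.comp (continuous_const.prodMk continuous_snd)
  have hev : ∀ᶠ p in 𝓝 y ×ˢ 𝓝 x, J v p.2 < J p.1 p.2 := by
    rw [← nhds_prod_eq]
    exact hcont.continuousAt.eventually_lt hJ.continuousAt hlt
  obtain ⟨p, hp, q, hq, hpq⟩ := eventually_prod_iff.1 hev
  have hfr := (mapClusterPt_iff_frequently.1 hcl _ hp).and_eventually hq
  obtain ⟨z, hz₁, hz₂⟩ := hfr.exists
  exact (hpq hz₁ hz₂).not_ge (hb z v hv)

/-- Lagrange interpolation of the polynomial `t ↦ det (1 + t A)`. -/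
theorem ContinuousLinearMap.det_one_add_eq_sum_lagrange {E : Type*} [NormedAddCommGroup E]
    [NormedSpace ℝ E] [FiniteDimensional ℝ E] (A : E →L[ℝ] E) {s : Finset ℝ}
    (hs : s.card = Module.finrank ℝ E + 1) :
    (1 + A).det = ∑ t ∈ s, (1 + t • A).det * (Lagrange.basis s id t).eval 1 := by
  classical
  let b := Module.finBasis ℝ E
  let M := LinearMap.toMatrix b b (A : E →ₗ[ℝ] E)
  let p : Polynomial ℝ := ((Polynomial.X : Polynomial ℝ) • M.map Polynomial.C +
    (1 : Matrix _ _ ℝ).map Polynomial.C).det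
  have hp (t : ℝ) : p.eval t = (1 + t • A).det := by
    have hM : LinearMap.toMatrix b b ((1 + t • A : E →L[ℝ] E) : E →ₗ[ℝ] E) = t • M + 1 := by
      have : ((1 + t • A : E →L[ℝ] E) : E →ₗ[ℝ] E) = 1 + t • (A : E →ₗ[ℝ] E) := rfl
      rw [this, map_add, map_smul, LinearMap.toMatrix_one, add_comm]
    rw [ContinuousLinearMap.det, ← LinearMap.det_toMatrix b, hM]
    simp only [p]
    rw [← Polynomial.coe_evalRingHom, RingHom.map_det]
    congr 1
    ext i j
    by_cases h : i = j <;> simp [h, mul_comm t]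
  have hdeg : p.degree < s.card := by
    refine Polynomial.degree_le_natDegree.trans_lt (Nat.cast_lt.2 ?_)
    rw [hs, Nat.lt_succ_iff]
    simpa only [Fintype.card_fin] using Polynomial.natDegree_det_X_add_C_le M 1
  have h1 := hp 1
  rw [one_smul] at h1
  rw [← h1, Lagrange.eq_interpolate (s := s) (v := id) injective_id.injOn hdeg,
    Lagrange.interpolate_apply, Polynomial.eval_finsetSum]
  exact Finset.sum_congr rfl fun t _ => by simp [hp]

section InnerProductSpace

variable {E : Type*} [NormedAddCommGroup E] [InnerProductSpace ℝ E]

/-- The radial projection onto the closed ball of radius `ρ` around the origin. -/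
noncomputable def radialProj (ρ : ℝ) (x : E) : E := (ρ / max ρ ‖x‖) • x

theorem radialProj_of_norm_le {ρ : ℝ} (hρ : 0 < ρ) {x : E} (hx : ‖x‖ ≤ ρ) :
    radialProj ρ x = x := by
  rw [radialProj, max_eq_left hx, div_self hρ.ne', one_smul]

theorem radialProj_of_le_norm {ρ : ℝ} {x : E} (hx : ρ ≤ ‖x‖) :
    radialProj ρ x = (ρ / ‖x‖) • x := by
  rw [radialProj, max_eq_right hx]

theorem norm_radialProj_of_le_norm {ρ : ℝ} (hρ : 0 < ρ) {x : E} (hx : ρ ≤ ‖x‖) :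
    ‖radialProj ρ x‖ = ρ := by
  have : 0 < ‖x‖ := hρ.trans_le hx
  rw [radialProj_of_le_norm hx, norm_smul, Real.norm_of_nonneg (by positivity),
    div_mul_cancel₀ _ this.ne']

theorem norm_radialProj_le {ρ : ℝ} (hρ : 0 < ρ) (x : E) : ‖radialProj ρ x‖ ≤ ρ := by
  rcases le_total ‖x‖ ρ with hx | hx
  · rwa [radialProj_of_norm_le hρ hx]
  · exact (norm_radialProj_of_le_norm hρ hx).le

theorem inner_sub_radialProj_nonneg {ρ : ℝ} (hρ : 0 < ρ) (x : E) {z : E} (hz : ‖z‖ ≤ ρ) :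
    0 ≤ inner ℝ (x - radialProj ρ x) (radialProj ρ x - z) := by
  rcases le_total ‖x‖ ρ with hx | hx
  · simp [radialProj_of_norm_le hρ hx]
  · have hx0 : 0 < ‖x‖ := hρ.trans_le hx
    have hP := norm_radialProj_of_le_norm hρ hx
    have hxP : x - radialProj ρ x = (‖x‖ / ρ - 1) • radialProj ρ x := by
      rw [sub_smul, one_smul, radialProj_of_le_norm hx, smul_smul,
        div_mul_div_cancel₀ hρ.ne', div_self hx0.ne', one_smul]
    rw [hxP, real_inner_smul_left, inner_sub_right, real_inner_self_eq_norm_sq, hP]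
    refine mul_nonneg (sub_nonneg.2 ((one_le_div hρ).2 hx)) (sub_nonneg.2 ?_)
    calc inner ℝ (radialProj ρ x) z ≤ ‖radialProj ρ x‖ * ‖z‖ := real_inner_le_norm _ _
      _ ≤ ρ ^ 2 := by rw [hP, sq]; gcongr

theorem lipschitzWith_radialProj {ρ : ℝ} (hρ : 0 < ρ) :
    LipschitzWith 1 (radialProj ρ : E → E) := by
  refine LipschitzWith.of_dist_le_mul fun x y => ?_
  rw [dist_eq_norm, dist_eq_norm, NNReal.coe_one, one_mul]
  set p := radialProj ρ x
  set q := radialProj ρ y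
  have h₁ : 0 ≤ inner ℝ (x - p) (p - q) :=
    inner_sub_radialProj_nonneg hρ x (norm_radialProj_le hρ y)
  have h₂ : 0 ≤ inner ℝ (y - q) (q - p) :=
    inner_sub_radialProj_nonneg hρ y (norm_radialProj_le hρ x)
  have h₃ : inner ℝ (x - y) (p - q) =
      inner ℝ (p - q) (p - q) + inner ℝ (x - p) (p - q) + inner ℝ (y - q) (q - p) := by
    simp only [inner_sub_left, inner_sub_right]
    ring
  rw [real_inner_self_eq_norm_sq] at h₃
  have h₄ := real_inner_le_norm (x - y) (p - q)
  by_contra! hlt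
  nlinarith [norm_nonneg (x - y)]

/-- A small perturbation of the identity towards a retraction of the closed ball onto the sphere
maps the closed ball bijectively onto itself. -/
theorem bijOn_closedBall_of_retraction [CompleteSpace E] {ρ : ℝ} (hρ : 0 < ρ) {r : E → E} {K : ℝ≥0}
    (hK : LipschitzOnWith K r (closedBall 0 ρ)) (hr : ∀ x, ‖r x‖ = ρ)
    (hr' : ∀ x, ‖x‖ = ρ → r x = x) {t : ℝ} (ht₀ : 0 < t) (ht₁ : t * (K + 1) < 1) :
    BijOn (fun x => x + t • (r x - x)) (closedBall 0 ρ) (closedBall 0 ρ) := by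
  have ht : t < 1 := by nlinarith [K.coe_nonneg]
  have hG : LipschitzWith (K + 1) fun x => r (radialProj ρ x) - x := by
    have hmaps : MapsTo (radialProj ρ : E → E) univ (closedBall 0 ρ) := fun x _ => by
      simpa using norm_radialProj_le hρ x
    have h := hK.comp (lipschitzWith_radialProj hρ).lipschitzOnWith hmaps
    rw [mul_one, lipschitzOnWith_univ] at h
    exact h.sub LipschitzWith.id
  have hcontr (y : E) : ContractingWith (t.toNNReal * (K + 1))
      fun x => y - t • (r (radialProj ρ x) - x) := by
    refine ⟨?_, LipschitzWith.of_dist_le_mul fun a b => ?_⟩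
    · rw [← NNReal.coe_lt_coe]
      simpa [ht₀.le] using ht₁
    · rw [dist_sub_left, dist_smul₀, Real.norm_of_nonneg ht₀.le]
      have := hG.dist_le_mul a b
      simp only [NNReal.coe_mul, Real.coe_toNNReal _ ht₀.le, mul_assoc]
      gcongr
  refine ⟨fun x hx => ?_, fun x hx y hy hxy => ?_, fun y hy => ?_⟩
  · rw [mem_closedBall_zero_iff] at hx ⊢
    calc ‖x + t • (r x - x)‖ = ‖(1 - t) • x + t • r x‖ := by congr 1; module
      _ ≤ (1 - t) * ‖x‖ + t * ‖r x‖ := by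
        refine (norm_add_le _ _).trans_eq ?_
        rw [norm_smul, norm_smul, Real.norm_of_nonneg ht₀.le, Real.norm_of_nonneg (by linarith)]
      _ ≤ ρ := by rw [hr]; nlinarith
  · rw [mem_closedBall_zero_iff] at hx hy
    refine (hcontr (x + t • (r x - x))).fixedPoint_unique' (x := x) (y := y) ?_ ?_
    · simp [IsFixedPt, radialProj_of_norm_le hρ hx]
    · simp only at hxy
      simp [IsFixedPt, radialProj_of_norm_le hρ hy, hxy]
  · rw [mem_closedBall_zero_iff] at hy
    have hfix := (hcontr y).fixedPoint_isFixedPt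
    set x := ContractingWith.fixedPoint _ (hcontr y)
    have hxy : x + t • (r (radialProj ρ x) - x) = y := by
      nth_rewrite 1 [← hfix.eq]
      exact sub_add_cancel _ _
    have hx : ‖x‖ ≤ ρ := by
      by_contra! hlt
      have hx0 : 0 < ‖x‖ := hρ.trans hlt
      rw [hr' _ (norm_radialProj_of_le_norm hρ hlt.le), radialProj_of_le_norm hlt.le] at hxy
      have hy' : y = ((1 - t) + t * (ρ / ‖x‖)) • x := by rw [← hxy]; module
      have hpos : 0 ≤ (1 - t) + t * (ρ / ‖x‖) := by
        have : 0 < ρ / ‖x‖ := by positivity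
        nlinarith
      rw [hy', norm_smul, Real.norm_of_nonneg hpos, add_mul, mul_assoc,
        div_mul_cancel₀ _ hx0.ne'] at hy
      nlinarith
    refine ⟨x, mem_closedBall_zero_iff.2 hx, ?_⟩
    rwa [radialProj_of_norm_le hρ hx] at hxy

/-- A map into a sphere has nowhere invertible derivative. -/
theorem det_fderiv_eq_zero_of_norm_eq [FiniteDimensional ℝ E] {ρ : ℝ} (hρ : 0 < ρ) {r : E → E}
    (hr : ∀ x, ‖r x‖ = ρ) {x : E} (hd : DifferentiableAt ℝ r x) :
    (fderiv ℝ r x).det = 0 := by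
  by_contra hdet
  have horth (v : E) : inner ℝ (r x) (fderiv ℝ r x v) = 0 := by
    have h₁ := hd.hasFDerivAt.norm_sq
    have h₂ : HasFDerivAt (fun y => ‖r y‖ ^ 2) (0 : E →L[ℝ] ℝ) x := by
      simp only [hr]
      exact hasFDerivAt_const _ _
    have h₃ := congrArg (fun L : E →L[ℝ] ℝ => L v) (h₁.unique h₂)
    simpa using h₃
  obtain ⟨v, hv⟩ := ((fderiv ℝ r x : E →ₗ[ℝ] E).equivOfDetNeZero hdet).surjective (r x)
  have hv' : fderiv ℝ r x v = r x := hv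
  have h := horth v
  rw [hv', real_inner_self_eq_norm_sq, hr] at h
  exact (pow_pos hρ 2).ne' h

/-- There is no continuously differentiable retraction of a closed ball onto its boundary. -/
theorem not_exists_contDiff_retraction [FiniteDimensional ℝ E] {ρ : ℝ} (hρ : 0 < ρ) {r : E → E}
    (hd : ContDiff ℝ 1 r) (hr : ∀ x, ‖r x‖ = ρ) (hr' : ∀ x, ‖x‖ = ρ → r x = x) : False := by
  borelize E
  let μ : Measure E := volume
  let B : Set E := closedBall 0 ρ
  have hB : IsCompact B := isCompact_closedBall 0 ρ
  have hfd : Continuous (fderiv ℝ r) := hd.continuous_fderiv one_ne_zero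
  let A (x : E) : E →L[ℝ] E := fderiv ℝ r x - 1
  have hA : Continuous A := hfd.sub continuous_const
  have hdetc : Continuous fun p : ℝ × E => (1 + p.1 • A p.2).det :=
    ContinuousLinearMap.continuous_det.comp
      (continuous_const.add (continuous_fst.smul (hA.comp continuous_snd)))
  obtain ⟨K, hK⟩ : ∃ K, LipschitzOnWith K r B :=
    (hd.locallyLipschitz.locallyLipschitzOn).exists_lipschitzOnWith_of_compact hB
  have hpos : ∀ᶠ t in 𝓝 (0 : ℝ), ∀ x ∈ B, 0 < (1 + t • A x).det := by
    refine hB.eventually_forall_of_forall_eventually fun x _ => ?_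
    refine hdetc.continuousAt.eventually (lt_mem_nhds ?_)
    simp [ContinuousLinearMap.det]
  have hsmall : ∀ᶠ t : ℝ in 𝓝 0, t * (K + 1) < 1 := by
    have : Continuous fun t : ℝ => t * ((K : ℝ) + 1) := by fun_prop
    exact this.continuousAt.eventually_lt continuousAt_const (by simp)
  obtain ⟨δ, hδ, hball⟩ := Metric.eventually_nhds_iff.1 (hpos.and hsmall)
  have hint (t : ℝ) : IntegrableOn (fun x => (1 + t • A x).det) B μ :=
    (hdetc.comp (Continuous.prodMk_right t)).continuousOn.integrableOn_compact hB
  have hvol (t : ℝ) (ht : t ∈ Ioo 0 δ) : ∫ x in B, (1 + t • A x).det ∂μ = μ.real B := by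
    obtain ⟨hp, hs⟩ := hball (y := t) (by simpa [abs_of_pos ht.1] using ht.2)
    have hbij := bijOn_closedBall_of_retraction hρ hK hr hr' ht.1 hs
    have hderiv (x : E) (_ : x ∈ B) :
        HasFDerivWithinAt (fun x => x + t • (r x - x)) (1 + t • A x) B x :=
      ((hasFDerivAt_id x).add ((((hd.differentiable one_ne_zero) x).hasFDerivAt.sub
        (hasFDerivAt_id x)).const_smul t)).hasFDerivWithinAt
    have h := integral_image_eq_integral_abs_det_fderiv_smul μ hB.measurableSet hderiv
      hbij.injOn fun _ => (1 : ℝ)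
    rw [hbij.image_eq] at h
    simp only [integral_const, smul_eq_mul, mul_one, measureReal_restrict_apply_univ] at h
    rw [h]
    exact setIntegral_congr_fun hB.measurableSet fun x hx => (abs_of_pos (hp x hx)).symm
  obtain ⟨s, hsub, hcard⟩ := (Ioo_infinite hδ).exists_subset_card_eq (Module.finrank ℝ E + 1)
  have hne : s.Nonempty := Finset.card_pos.1 (by omega)
  have hzero : ∫ x in B, (1 + A x).det ∂μ = 0 := by
    have h (x : E) : (1 + A x).det = 0 := by
      rw [add_sub_cancel]
      exact det_fderiv_eq_zero_of_norm_eq hρ hr (hd.differentiable one_ne_zero x)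
    simp [h]
  have hsum : ∫ x in B, (1 + A x).det ∂μ = μ.real B := by
    simp_rw [fun x => (A x).det_one_add_eq_sum_lagrange hcard]
    rw [integral_finsetSum _ fun t _ => (hint t).mul_const _]
    simp_rw [integral_mul_const]
    rw [Finset.sum_congr rfl fun t ht => by rw [hvol t (hsub ht)], ← Finset.mul_sum,
      ← Polynomial.eval_finsetSum, Lagrange.sum_basis injective_id.injOn hne,
      Polynomial.eval_one, mul_one]
  have hBpos : 0 < μ.real B :=
    ENNReal.toReal_pos (measure_closedBall_pos μ 0 hρ).ne' hB.measure_lt_top.ne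
  exact hBpos.ne' (hsum.symm.trans hzero)

/-- **Brouwer's fixed point theorem**, for a continuous bounded map of a Euclidean space. -/
theorem exists_isFixedPt_of_continuous_of_norm_le [FiniteDimensional ℝ E] {f : E → E} {M : ℝ}
    (hf : Continuous f) (hM : ∀ x, ‖f x‖ ≤ M) : ∃ x, IsFixedPt f x := by
  by_contra! hfix
  have hM₀ : 0 ≤ M := (norm_nonneg _).trans (hM 0)
  let χ (x : E) : ℝ := max 0 (min 1 (M + 1 - ‖x‖))
  have hχ : Continuous χ := by fun_prop
  have hne (x : E) : x ≠ χ x • f x := by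
    intro hx
    rcases le_or_gt ‖x‖ M with h | h
    · have hχ₁ : χ x = 1 := by
        simp only [χ]
        rw [min_eq_left (by linarith), max_eq_right zero_le_one]
      rw [hχ₁, one_smul] at hx
      exact hfix x hx.symm
    · have h₀ : 0 ≤ χ x := le_max_left _ _
      have h₁ : χ x ≤ 1 := max_le zero_le_one (min_le_left _ _)
      have := congrArg norm hx
      rw [norm_smul, Real.norm_of_nonneg h₀] at this
      nlinarith [norm_nonneg (f x), hM x]
  obtain ⟨g, hg, hgd, hgs⟩ := (hχ.smul hf).exists_contDiff_approx 1
    (ε := fun x => ‖x - χ x • f x‖) (by fun_prop) fun x => norm_pos_iff.2 (sub_ne_zero.2 (hne x))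
  have hgx (x : E) : x - g x ≠ 0 := by
    intro h
    have := hgd x
    rw [← sub_eq_zero.1 h, dist_eq_norm] at this
    exact this.false
  have hg₀ (x : E) (hx : ‖x‖ = M + 1) : g x = 0 := by
    by_contra h
    refine hgs h ?_
    simp [χ, hx]
  have hρ : 0 < M + 1 := by linarith
  refine not_exists_contDiff_retraction hρ (r := fun x => ((M + 1) / ‖x - g x‖) • (x - g x))
    ?_ (fun x => ?_) fun x hx => ?_
  · have hsub : ContDiff ℝ 1 fun x => x - g x := contDiff_id.sub hg
    exact (contDiff_const.div (hsub.norm ℝ hgx) fun x => norm_ne_zero_iff.2 (hgx x)).smul hsub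
  · rw [norm_smul, Real.norm_of_nonneg (by positivity),
      div_mul_cancel₀ _ (norm_ne_zero_iff.2 (hgx x))]
  · simp only [hg₀ x hx, sub_zero, hx, div_self hρ.ne', one_smul]

theorem strictConvexOn_norm_sub_sq {s : Set E} (hs : Convex ℝ s) (x : E) :
    StrictConvexOn ℝ s fun u => ‖u - x‖ ^ 2 := by
  refine ⟨hs, fun u _ v _ huv a b ha hb hab => ?_⟩
  have hpos : 0 < ‖u - v‖ ^ 2 := pow_pos (norm_pos_iff.2 (sub_ne_zero.2 huv)) 2
  have h₁ : a • u + b • v - x = a • (u - x) + b • (v - x) := by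
    obtain rfl : b = 1 - a := by linarith
    module
  have h₂ : u - v = (u - x) - (v - x) := by abel
  have h₃ : ‖a • (u - x) + b • (v - x)‖ ^ 2 =
      a ^ 2 * ‖u - x‖ ^ 2 + 2 * (a * b) * inner ℝ (u - x) (v - x) + b ^ 2 * ‖v - x‖ ^ 2 := by
    rw [norm_add_sq_real, norm_smul, norm_smul, real_inner_smul_left, real_inner_smul_right,
      mul_pow, mul_pow, Real.norm_eq_abs, Real.norm_eq_abs, sq_abs, sq_abs]
    ring
  simp only [smul_eq_mul]
  rw [h₁, h₃]
  rw [h₂, norm_sub_sq_real] at hpos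
  obtain rfl : b = 1 - a := by linarith
  nlinarith [mul_pos (mul_pos ha hb) hpos]

end InnerProductSpace

/-- **Brouwer's fixed point theorem** for compact convex subsets of finite-dimensional spaces. -/
theorem Convex.exists_isFixedPt_of_isCompact {E : Type*} [NormedAddCommGroup E] [NormedSpace ℝ E]
    [FiniteDimensional ℝ E] {U : Set E} (hconv : Convex ℝ U) (hU : IsCompact U)
    (hne : U.Nonempty) {f : U → U} (hf : Continuous f) : ∃ x, IsFixedPt f x := by
  let L := toEuclidean (E := E)
  obtain ⟨P, hP, hPU⟩ := exists_continuous_minimizer (hne.image L) (hU.image L.continuous)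
    (J := fun u x => ‖u - x‖ ^ 2) (by fun_prop)
    fun x => strictConvexOn_norm_sub_sq (hconv.linear_image (L : E →ₗ[ℝ] _)) x
  have hPmem (x) : L.symm (P x) ∈ U := by
    obtain ⟨u, hu, hux⟩ := (hPU x).1
    rwa [← hux, L.symm_apply_apply]
  let F (x) := L (f ⟨L.symm (P x), hPmem x⟩)
  have hF : Continuous F := L.continuous.comp (continuous_subtype_val.comp
    (hf.comp ((L.symm.continuous.comp hP).subtype_mk hPmem)))
  obtain ⟨M, hM⟩ := (hU.image L.continuous).isBounded.exists_norm_le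
  obtain ⟨x, hx⟩ := exists_isFixedPt_of_continuous_of_norm_le hF
    fun x => hM _ (mem_image_of_mem L (f ⟨L.symm (P x), hPmem x⟩).2)
  have hxU : x ∈ L '' U := by
    rw [← hx.eq]
    exact mem_image_of_mem L (Subtype.coe_prop _)
  have hPx : P x = x := by
    have h := (hPU x).2 x hxU
    simp only [sub_self, norm_zero] at h
    refine sub_eq_zero.1 (norm_eq_zero.1 (pow_eq_zero_iff two_ne_zero |>.1 ?_))
    exact le_antisymm (by simpa using h) (by positivity)
  refine ⟨⟨L.symm (P x), hPmem x⟩, Subtype.ext ?_⟩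
  apply L.injective
  rw [L.apply_symm_apply]
  exact hx.eq.trans hPx.symm

/-- Two-player case of the Başar–Olsder existence theorem: on nonempty compact convex
action sets in finite-dimensional real normed spaces, jointly continuous cost functionals
that are strictly convex in each player's own action admit a pure-strategy Nash
equilibrium (each player minimizes their own cost). -/
theorem nash_existence_two_player
    {E₁ E₂ : Type*}
    [NormedAddCommGroup E₁] [NormedSpace ℝ E₁] [FiniteDimensional ℝ E₁]
    [NormedAddCommGroup E₂] [NormedSpace ℝ E₂] [FiniteDimensional ℝ E₂]
    (U₁ : Set E₁) (U₂ : Set E₂)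
    (hU₁ne : U₁.Nonempty) (hU₂ne : U₂.Nonempty)
    (hU₁cpt : IsCompact U₁) (hU₂cpt : IsCompact U₂)
    (hU₁conv : Convex ℝ U₁) (hU₂conv : Convex ℝ U₂)
    (J₁ J₂ : E₁ × E₂ → ℝ)
    (hJ₁cont : Continuous J₁) (hJ₂cont : Continuous J₂)
    (hJ₁conv : ∀ u₂ ∈ U₂, StrictConvexOn ℝ U₁ (fun u₁ => J₁ (u₁, u₂)))
    (hJ₂conv : ∀ u₁ ∈ U₁, StrictConvexOn ℝ U₂ (fun u₂ => J₂ (u₁, u₂))) :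
    ∃ u₁ ∈ U₁, ∃ u₂ ∈ U₂,
      (∀ v₁ ∈ U₁, J₁ (u₁, u₂) ≤ J₁ (v₁, u₂)) ∧
      (∀ v₂ ∈ U₂, J₂ (u₁, u₂) ≤ J₂ (u₁, v₂)) := by
  obtain ⟨b₁, hb₁, hb₁'⟩ := exists_continuous_minimizer (X := U₂) hU₁ne hU₁cpt
    (J := fun u x => J₁ (u, x)) (by fun_prop) fun x => hJ₁conv x x.2
  obtain ⟨b₂, hb₂, hb₂'⟩ := exists_continuous_minimizer (X := U₁) hU₂ne hU₂cpt
    (J := fun u x => J₂ (x, u)) (by fun_prop) fun x => hJ₂conv x x.2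
  let c₁ (x : U₂) : U₁ := ⟨b₁ x, (hb₁' x).1⟩
  let c₂ (x : U₁) : U₂ := ⟨b₂ x, (hb₂' x).1⟩
  obtain ⟨x, hx⟩ := hU₁conv.exists_isFixedPt_of_isCompact hU₁cpt hU₁ne (f := c₁ ∘ c₂)
    ((hb₁.subtype_mk _).comp (hb₂.subtype_mk _))
  have hx₁ : b₁ (c₂ x) = x := congrArg Subtype.val hx.eq
  refine ⟨x, x.2, c₂ x, (c₂ x).2, fun v hv => ?_, (hb₂' x).2⟩
  simpa only [hx₁] using (hb₁' (c₂ x)).2 v hv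
end

section
/- Suppose in addition that for every τ_a ≥ 0 the map τ ↦ G(τ − τ_a)/τ is convex on (0, T], and that for each λ the function τ_a ↦ f(τ_a; λ) is integrable on [0, ∞). Then for every fixed λ ∈ [λ_min, λ_max] the defender's payoff τ ↦ u_d(τ, λ) is strictly concave on [τ_min, T]. -/
open MeasureTheory Set

/-- Attacker payoff: `u_a(τ_d, λ) = ∫₀^{τ_d} G(τ_d − τ_a) f(τ_a; λ) dτ_a − λ C_a`. -/
noncomputable def uA (G : ℝ → ℝ) (f : ℝ → ℝ → ℝ) (Ca τd l : ℝ) : ℝ :=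
  (∫ τa in (0:ℝ)..τd, G (τd - τa) * f τa l) - l * Ca

/-- Defender payoff: `u_d(τ_d, λ) = −(∫₀^{τ_d} G(τ_d − τ_a) f(τ_a; λ) dτ_a + C_d)/τ_d`. -/
noncomputable def uD (G : ℝ → ℝ) (f : ℝ → ℝ → ℝ) (Cd τd l : ℝ) : ℝ :=
  -((∫ τa in (0:ℝ)..τd, G (τd - τa) * f τa l) + Cd) / τd

/-- The integral of a family of convex functions is convex. -/
theorem convexOn_integral_of_forall_ae {α : Type*} [MeasurableSpace α] {μ : Measure α}
    {s : Set ℝ} (hs : Convex ℝ s) {F : ℝ → α → ℝ}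
    (hF : ∀ᵐ a ∂μ, ConvexOn ℝ s (fun x => F x a)) (hint : ∀ x ∈ s, Integrable (F x) μ) :
    ConvexOn ℝ s (fun x => ∫ a, F x a ∂μ) := by
  refine ⟨hs, fun x hx y hy p q hp hq hpq => ?_⟩
  simp only [smul_eq_mul]
  rw [← integral_const_mul, ← integral_const_mul,
    ← integral_add ((hint x hx).const_mul p) ((hint y hy).const_mul q)]
  refine integral_mono_ae (hint _ (hs hx hy hp hq hpq))
    (((hint x hx).const_mul p).add ((hint y hy).const_mul q)) ?_
  filter_upwards [hF] with a ha
  exact ha.2 hx hy hp hq hpq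

/-- The accumulated reward against an integrable weight is integrable. -/
theorem integrableOn_reward_mul {G g : ℝ → ℝ} (hGcont : Continuous G) (hGmono : Monotone G)
    (hGnonneg : ∀ t, 0 ≤ G t) (hg : IntegrableOn g (Ioi 0)) (x : ℝ) :
    IntegrableOn (fun a => G (x - a) * g a) (Ioi 0) := by
  refine Integrable.bdd_mul (c := G x) hg
    (hGcont.comp (continuous_const.sub continuous_id)).aestronglyMeasurable ?_
  filter_upwards [ae_restrict_mem measurableSet_Ioi] with a ha
  rw [Real.norm_of_nonneg (hGnonneg _)]
  exact hGmono (sub_le_self x (le_of_lt ha))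

/-- The accumulated reward may be integrated over the whole half-line. -/
theorem intervalIntegral_reward_eq {G g : ℝ → ℝ} (hGzero : ∀ t ≤ 0, G t = 0) {x : ℝ}
    (hx : 0 ≤ x) :
    ∫ a in (0:ℝ)..x, G (x - a) * g a = ∫ a in Ioi (0:ℝ), G (x - a) * g a := by
  rw [intervalIntegral.integral_of_le hx]
  refine (setIntegral_eq_of_subset_of_forall_sdiff_eq_zero measurableSet_Ioi
    Ioc_subset_Ioi_self fun a ha => ?_).symm
  have hxa : x < a := by
    by_contra! h
    exact ha.2 ⟨ha.1, h⟩
  rw [hGzero _ (by linarith), zero_mul]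

/-- A positive multiple of the inverse is strictly convex on the positive half-line. -/
theorem strictConvexOn_const_div {c : ℝ} (hc : 0 < c) :
    StrictConvexOn ℝ (Ioi 0) (fun x : ℝ => c / x) := by
  have h := strictConvexOn_zpow (m := -1) (by norm_num) (by norm_num)
  refine ⟨h.1, fun x hx y hy hxy p q hp hq hpq => ?_⟩
  have := mul_lt_mul_of_pos_left (h.2 hx hy hxy hp hq hpq) hc
  simp only [smul_eq_mul, zpow_neg_one, div_eq_mul_inv] at this ⊢
  linarith

/-- If `τ ↦ G(τ − τ_a)/τ` is convex on `(0, T]` for every `τ_a ≥ 0` and `f(·; λ)` is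
integrable on `[0, ∞)` for each `λ`, then for every fixed `λ ∈ [λ_min, λ_max]` the
defender's payoff `τ ↦ u_d(τ, λ)` is strictly concave on `[τ_min, T]`. -/
theorem defender_payoff_strictConcave
    (τmin T lmin lmax Ca Cd : ℝ)
    (hτmin : 0 < τmin) (hτT : τmin ≤ T)
    (hlmin : 0 ≤ lmin) (hl : lmin ≤ lmax)
    (hCa : 0 < Ca) (hCd : 0 < Cd)
    (G : ℝ → ℝ) (hGcont : Continuous G) (hGmono : Monotone G)
    (hGnonneg : ∀ t, 0 ≤ G t) (hGzero : ∀ t ≤ 0, G t = 0)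
    (f : ℝ → ℝ → ℝ)
    (hfnonneg : ∀ τa, 0 ≤ τa → ∀ l ∈ Icc lmin lmax, 0 ≤ f τa l)
    (hfpdf : ∀ l ∈ Icc lmin lmax, ∫ τa in Ioi (0:ℝ), f τa l = 1)
    (hGconv : ∀ τa, 0 ≤ τa → ConvexOn ℝ (Ioc 0 T) (fun τ => G (τ - τa) / τ))
    (hfint : ∀ l ∈ Icc lmin lmax, IntegrableOn (fun τa => f τa l) (Ici 0)) :
    ∀ l ∈ Icc lmin lmax, StrictConcaveOn ℝ (Icc τmin T) (fun τ => uD G f Cd τ l) := by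
  intro l hlm
  have hf : IntegrableOn (fun a => f a l) (Ioi 0) := (hfint l hlm).mono_set Ioi_subset_Ici_self
  have hpos : ∀ τ ∈ Icc τmin T, 0 < τ := fun τ hτ => hτmin.trans_le hτ.1
  have hconv : ConvexOn ℝ (Icc τmin T)
      (fun τ => ∫ a in Ioi (0:ℝ), G (τ - a) / τ * f a l) := by
    refine convexOn_integral_of_forall_ae (convex_Icc _ _) ?_ fun τ _ => ?_
    · filter_upwards [ae_restrict_mem measurableSet_Ioi] with a ha
      have h := ((hGconv a (le_of_lt ha)).subset (fun τ hτ => ⟨hpos τ hτ, hτ.2⟩)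
        (convex_Icc τmin T)).smul (hfnonneg a (le_of_lt ha) l hlm)
      simpa only [smul_eq_mul, mul_comm] using h
    · have h := (integrableOn_reward_mul hGcont hGmono hGnonneg hf τ).div_const τ
      simpa only [div_mul_eq_mul_div] using h
  have hstrict := hconv.add_strictConvexOn
    ((strictConvexOn_const_div hCd).subset hpos (convex_Icc τmin T))
  refine hstrict.neg.congr fun τ hτ => ?_
  simp only [uD, Pi.neg_apply, Pi.add_apply,
    intervalIntegral_reward_eq hGzero (hpos τ hτ).le, div_mul_eq_mul_div, integral_div]
  ring
end

section
/- Fix τ_d ∈ [τ_min, T] and suppose λ_min < λ_max, f is jointly continuous with jointly continuous partial derivative ∂f/∂λ, and λ ↦ u_a(τ_d, λ) is strictly concave on [λ_min, λ_max]; then the partial derivative of u_a in λ equals ∂u_a/∂λ(τ_d, λ) = ∫₀^{τ_d} G(τ_d − τ_a) (∂f/∂λ)(τ_a; λ) dτ_a − C_a, and the attacker's best response is characterized as follows: (i) if ∫₀^{τ_d} G(τ_d − τ_a) (∂f/∂λ)(τ_a; λ) dτ_a > C_a for all λ ∈ [λ_min, λ_max], then λ_max is the unique maximizer of u_a(τ_d,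 ·) over [λ_min, λ_max]; (ii) if ∫₀^{τ_d} G(τ_d − τ_a) (∂f/∂λ)(τ_a; λ) dτ_a < C_a for all λ ∈ [λ_min, λ_max], then λ_min is the unique maximizer; (iii) if λ* ∈ [λ_min, λ_max] satisfies ∫₀^{τ_d} G(τ_d − τ_a) (∂f/∂λ)(τ_a; λ*) dτ_a = C_a, then λ* is the unique maximizer. -/
open MeasureTheory Set

/-- Differentiation under the integral sign over a compact interval, for a parameter ranging over
a convex compact set, with derivatives taken within that set. -/
theorem hasDerivWithinAt_intervalIntegral_of_continuousOn {F F' : ℝ → ℝ → ℝ} {a b : ℝ} {s : Set ℝ}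
    (hab : a ≤ b) (hs : IsCompact s) (hconv : Convex ℝ s)
    (hF : ContinuousOn (fun p : ℝ × ℝ => F p.1 p.2) (Icc a b ×ˢ s))
    (hF' : ContinuousOn (fun p : ℝ × ℝ => F' p.1 p.2) (Icc a b ×ˢ s))
    (hderiv : ∀ t ∈ Icc a b, ∀ x ∈ s, HasDerivWithinAt (F t) (F' t x) s x)
    {x : ℝ} (hx : x ∈ s) :
    HasDerivWithinAt (fun y => ∫ t in a..b, F t y) (∫ t in a..b, F' t x) s x := by
  obtain ⟨M, hM⟩ := (isCompact_Icc.prod hs).exists_bound_of_continuousOn hF'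
  have hint : ∀ y ∈ s, IntervalIntegrable (fun t => F t y) volume a b := fun y hy =>
    ContinuousOn.intervalIntegrable_of_Icc hab <|
      hF.comp (f := fun t => (t, y)) (by fun_prop) fun _ ht => ⟨ht, hy⟩
  have hsub : uIoc a b ⊆ Icc a b := by
    rw [uIoc_of_le hab]
    exact Ioc_subset_Icc_self
  have hmem : ∀ᶠ y in nhdsWithin x (s \ {x}), y ∈ s :=
    eventually_mem_nhdsWithin.mono fun _ hy => hy.1
  rw [hasDerivWithinAt_iff_tendsto_slope]
  have hslope : (fun y => ∫ t in a..b, slope (F t) x y) =ᶠ[nhdsWithin x (s \ {x})]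
      slope (fun y => ∫ t in a..b, F t y) x := by
    filter_upwards [hmem] with y hy
    simp only [slope_def_module, smul_eq_mul]
    rw [intervalIntegral.integral_const_mul, intervalIntegral.integral_sub (hint y hy) (hint x hx)]
  refine Filter.Tendsto.congr' hslope ?_
  refine intervalIntegral.tendsto_integral_filter_of_dominated_convergence (fun _ => M) ?_ ?_
    intervalIntegrable_const ?_
  · filter_upwards [hmem] with y hy
    simp only [slope_def_module, smul_eq_mul]
    exact (((hint y hy).sub (hint x hx)).const_mul _).def'.aestronglyMeasurable
  · filter_upwards [eventually_mem_nhdsWithin] with y hy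
    refine Filter.Eventually.of_forall fun t ht => ?_
    have hpos : 0 < ‖y - x‖ := norm_pos_iff.2 (sub_ne_zero.2 hy.2)
    rw [slope_def_field, norm_div, div_le_iff₀ hpos]
    exact hconv.norm_image_sub_le_of_norm_hasDerivWithin_le (hderiv t (hsub ht))
      (fun z hz => hM (t, z) ⟨hsub ht, hz⟩) hx hy.1
  · exact Filter.Eventually.of_forall fun t ht =>
      hasDerivWithinAt_iff_tendsto_slope.1 (hderiv t (hsub ht) x hx)

/-- First-order sufficient condition for a point to be the unique maximizer of a strictly concave
function. -/
theorem StrictConcaveOn.lt_of_hasDerivWithinAt_of_mul_nonpos {g : ℝ → ℝ} {g' : ℝ} {s : Set ℝ}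
    {x y : ℝ} (hg : StrictConcaveOn ℝ s g) (hx : x ∈ s) (hy : y ∈ s) (hyx : y ≠ x)
    (hd : HasDerivWithinAt g g' s x) (hle : g' * (y - x) ≤ 0) : g y < g x := by
  rcases hyx.lt_or_gt with h | h
  · have hlt := hg.lt_slope_of_hasDerivWithinAt hy hx h hd
    rw [slope_def_field, lt_div_iff₀ (sub_pos.2 h)] at hlt
    linarith
  · have hlt := hg.slope_lt_of_hasDerivWithinAt hx hy h hd
    rw [slope_def_field, div_lt_iff₀ (sub_pos.2 h)] at hlt
    linarith

/-- Attacker's best-response characterization (general payoffs): the derivative of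
`λ ↦ u_a(τ_d, λ)` is `∫₀^{τ_d} G(τ_d − τ_a) ∂f/∂λ(τ_a; λ) dτ_a − C_a`, and depending on its
sign the unique maximizer is `λ_max`, `λ_min`, or an interior stationary point. -/
theorem attacker_best_response_general
    (τmin T lmin lmax Ca Cd : ℝ)
    (hτmin : 0 < τmin) (hτT : τmin ≤ T)
    (hlmin : 0 ≤ lmin) (hl : lmin < lmax)
    (hCa : 0 < Ca) (hCd : 0 < Cd)
    (G : ℝ → ℝ) (hGcont : Continuous G) (hGmono : Monotone G)
    (hGnonneg : ∀ t, 0 ≤ G t) (hGzero : ∀ t ≤ 0, G t = 0)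
    (f f' : ℝ → ℝ → ℝ)
    (hfnonneg : ∀ τa, 0 ≤ τa → ∀ l ∈ Icc lmin lmax, 0 ≤ f τa l)
    (hfpdf : ∀ l ∈ Icc lmin lmax, ∫ τa in Ioi (0:ℝ), f τa l = 1)
    (hfcont : ContinuousOn (fun p : ℝ × ℝ => f p.1 p.2) (Ici 0 ×ˢ Icc lmin lmax))
    (hf'cont : ContinuousOn (fun p : ℝ × ℝ => f' p.1 p.2) (Ici 0 ×ˢ Icc lmin lmax))
    (hfderiv : ∀ τa, 0 ≤ τa → ∀ l ∈ Icc lmin lmax,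
      HasDerivWithinAt (fun x => f τa x) (f' τa l) (Icc lmin lmax) l)
    (τd : ℝ) (hτd : τd ∈ Icc τmin T)
    (huaconc : StrictConcaveOn ℝ (Icc lmin lmax) (fun l => uA G f Ca τd l)) :
    (∀ l ∈ Icc lmin lmax,
      HasDerivWithinAt (fun x => uA G f Ca τd x)
        ((∫ τa in (0:ℝ)..τd, G (τd - τa) * f' τa l) - Ca) (Icc lmin lmax) l) ∧
    ((∀ l ∈ Icc lmin lmax, Ca < ∫ τa in (0:ℝ)..τd, G (τd - τa) * f' τa l) →
      ∀ l ∈ Icc lmin lmax, l ≠ lmax → uA G f Ca τd l < uA G f Ca τd lmax) ∧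
    ((∀ l ∈ Icc lmin lmax, (∫ τa in (0:ℝ)..τd, G (τd - τa) * f' τa l) < Ca) →
      ∀ l ∈ Icc lmin lmax, l ≠ lmin → uA G f Ca τd l < uA G f Ca τd lmin) ∧
    (∀ lstar ∈ Icc lmin lmax, (∫ τa in (0:ℝ)..τd, G (τd - τa) * f' τa lstar) = Ca →
      ∀ l ∈ Icc lmin lmax, l ≠ lstar → uA G f Ca τd l < uA G f Ca τd lstar) := by
  have hτd0 : 0 ≤ τd := hτmin.le.trans hτd.1
  have hsub : Icc 0 τd ×ˢ Icc lmin lmax ⊆ Ici 0 ×ˢ Icc lmin lmax :=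
    prod_mono Icc_subset_Ici_self subset_rfl
  have hG : ContinuousOn (fun p : ℝ × ℝ => G (τd - p.1)) (Icc 0 τd ×ˢ Icc lmin lmax) := by
    fun_prop
  have hderiv : ∀ l ∈ Icc lmin lmax, HasDerivWithinAt (fun x => uA G f Ca τd x)
      ((∫ τa in (0:ℝ)..τd, G (τd - τa) * f' τa l) - Ca) (Icc lmin lmax) l := by
    intro l hl
    have hint := hasDerivWithinAt_intervalIntegral_of_continuousOn hτd0 isCompact_Icc
      (convex_Icc lmin lmax) (hG.mul (hfcont.mono hsub)) (hG.mul (hf'cont.mono hsub))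
      (fun t ht x hx => (hfderiv t ht.1 x hx).const_mul (G (τd - t))) hl
    have hsum := hint.sub ((hasDerivWithinAt_id l _).mul_const Ca)
    rw [one_mul] at hsum
    exact hsum
  have hmin : lmin ∈ Icc lmin lmax := left_mem_Icc.2 hl.le
  have hmax : lmax ∈ Icc lmin lmax := right_mem_Icc.2 hl.le
  refine ⟨hderiv, fun h l hl hne => ?_, fun h l hl hne => ?_, fun lstar hstar h l hl hne => ?_⟩
  · exact huaconc.lt_of_hasDerivWithinAt_of_mul_nonpos hmax hl hne (hderiv _ hmax)
      (mul_nonpos_of_nonneg_of_nonpos (sub_nonneg.2 (h _ hmax).le) (sub_nonpos.2 hl.2))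
  · exact huaconc.lt_of_hasDerivWithinAt_of_mul_nonpos hmin hl hne (hderiv _ hmin)
      (mul_nonpos_of_nonpos_of_nonneg (sub_nonpos.2 (h _ hmin).le) (sub_nonneg.2 hl.1))
  · exact huaconc.lt_of_hasDerivWithinAt_of_mul_nonpos hstar hl hne (hderiv _ hstar)
      (by rw [h, sub_self, zero_mul])
end

section
/- Fix λ ∈ [λ_min, λ_max] and suppose τ_min < T, G is continuously differentiable with G(0) = 0 and derivative G′, f is jointly continuous, and τ ↦ u_d(τ, λ) is strictly concave on [τ_min, T]; then the partial derivative of u_d in τ equals ∂u_d/∂τ(τ, λ) = (C_d − ∫₀^{τ} (τ G′(τ − τ_a) − G(τ − τ_a)) f(τ_a; λ) dτ_a)/τ², and the defender's best response is characterized as follows: (i) if ∫₀^{τ} (τ G′(τ − τ_a) − G(τ − τ_a)) f(τ_a; λ) dτ_a < C_d for all τ ∈ [τ_min, T], then T is the unique maximizer of u_d(·, λ) over [τ_min, T]; (ii) if ∫₀^{τ} (τ G′(τ − τ_a) − G(τ − τ_a)) f(τ_a; λ) dτ_a > C_d for all τ ∈ [τ_min, T], then τ_min is the unique maximizer; (iii)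 if τ* ∈ [τ_min, T] satisfies ∫₀^{τ*} (τ* G′(τ* − τ_a) − G(τ* − τ_a)) f(τ_a; λ) dτ_a = C_d, then τ* is the unique maximizer. -/
open MeasureTheory Set

theorem HasDerivAt.eq_zero_of_eq_zero_left {G : ℝ → ℝ} {d t : ℝ} (hG : HasDerivAt G d t)
    (hzero : ∀ s ≤ t, G s = 0) : d = 0 :=
  (uniqueDiffWithinAt_Iic t).eq_deriv _ hG.hasDerivWithinAt
    ((hasDerivWithinAt_const t (Iic t) (0 : ℝ)).congr (fun s hs => hzero s hs) (hzero t le_rfl))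

theorem ContinuousOn.intervalIntegrable_convolution {φ g : ℝ → ℝ} (hφ : Continuous φ)
    (hg : ContinuousOn g (Ici 0)) (x : ℝ) {a b : ℝ} (ha : 0 ≤ a) (hb : 0 ≤ b) :
    IntervalIntegrable (fun s => φ (x - s) * g s) volume a b := by
  apply ContinuousOn.intervalIntegrable
  have hsub : uIcc a b ⊆ Ici 0 := fun s hs => (le_inf ha hb).trans hs.1
  exact (Continuous.continuousOn (by fun_prop)).mul (hg.mono hsub)

theorem intervalIntegral_convolution_extend {φ g : ℝ → ℝ} (hφ : Continuous φ)
    (hzero : ∀ t ≤ 0, φ t = 0) (hg : ContinuousOn g (Ici 0)) {x b : ℝ} (hx : 0 ≤ x) (hxb : x ≤ b) :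
    ∫ s in (0 : ℝ)..x, φ (x - s) * g s = ∫ s in (0 : ℝ)..b, φ (x - s) * g s := by
  have hb := hx.trans hxb
  rw [← intervalIntegral.integral_add_adjacent_intervals
    (hg.intervalIntegrable_convolution hφ x le_rfl hx)
    (hg.intervalIntegrable_convolution hφ x hx hb)]
  have hrest : ∫ s in x..b, φ (x - s) * g s = 0 := by
    refine intervalIntegral.integral_zero_ae (Filter.Eventually.of_forall fun s hs => ?_)
    rw [uIoc_of_le hxb] at hs
    rw [hzero (x - s) (by linarith [hs.1]), zero_mul]
  rw [hrest, add_zero]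

/-- Differentiation of a causal convolution: no boundary term appears since the kernel `G`
vanishes on the nonpositive half-line. -/
theorem hasDerivAt_causal_convolution {G G' g : ℝ → ℝ} (hG : ∀ t, HasDerivAt G (G' t) t)
    (hG' : Continuous G') (hzero : ∀ t ≤ 0, G t = 0) (hg : ContinuousOn g (Ici 0))
    {x : ℝ} (hx : 0 < x) :
    HasDerivAt (fun y => ∫ s in (0 : ℝ)..y, G (y - s) * g s)
      (∫ s in (0 : ℝ)..x, G' (x - s) * g s) x := by
  have hGc : Continuous G := continuous_iff_continuousAt.2 fun t => (hG t).continuousAt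
  have hzero' : ∀ t ≤ 0, G' t = 0 := fun t ht =>
    (hG t).eq_zero_of_eq_zero_left fun s hs => hzero s (hs.trans ht)
  have hb : (0 : ℝ) ≤ x + 1 := by linarith
  obtain ⟨M, hM⟩ := (isCompact_Icc (a := -1) (b := x + 1)).exists_bound_of_continuousOn
    hG'.continuousOn
  have hgint : IntervalIntegrable g volume 0 (x + 1) :=
    (hg.mono fun s hs => by rw [uIcc_of_le hb] at hs; exact hs.1).intervalIntegrable
  have hnhds : Ioo 0 (x + 1) ∈ nhds x := Ioo_mem_nhds hx (by linarith)
  have key := (intervalIntegral.hasDerivAt_integral_of_dominated_loc_of_deriv_le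
    (μ := volume) (F := fun y s => G (y - s) * g s) (F' := fun y s => G' (y - s) * g s)
    (bound := fun s => M * ‖g s‖) hnhds
    (Filter.Eventually.of_forall fun y => (intervalIntegrable_iff.1
      (hg.intervalIntegrable_convolution hGc y le_rfl hb)).aestronglyMeasurable)
    (hg.intervalIntegrable_convolution hGc x le_rfl hb)
    (intervalIntegrable_iff.1
      (hg.intervalIntegrable_convolution hG' x le_rfl hb)).aestronglyMeasurable
    (Filter.Eventually.of_forall fun s hs y hy => by
      rw [uIoc_of_le hb] at hs
      rw [norm_mul]
      by_cases hsy : y - s ≤ 0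
      · have hM0 : 0 ≤ M := (norm_nonneg _).trans (hM 0 ⟨by norm_num, hb⟩)
        rw [hzero' _ hsy, norm_zero, zero_mul]
        positivity
      · exact mul_le_mul_of_nonneg_right
          (hM _ ⟨by linarith, by linarith [hs.1, hy.2]⟩) (norm_nonneg _))
    (hgint.norm.const_mul M)
    (Filter.Eventually.of_forall fun s _ y _ =>
      ((hG (y - s)).comp_sub_const y s).mul_const (g s))).2
  rw [intervalIntegral_convolution_extend hG' hzero' hg hx.le (by linarith : x ≤ x + 1)]
  refine key.congr_of_eventuallyEq ?_
  filter_upwards [hnhds] with y hy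
  exact intervalIntegral_convolution_extend hGc hzero hg hy.1.le hy.2.le

theorem StrictConcaveOn.lt_add_mul_sub_of_hasDerivWithinAt {S : Set ℝ} {u : ℝ → ℝ} {d x y : ℝ}
    (hu : StrictConcaveOn ℝ S u) (hx : x ∈ S) (hy : y ∈ S) (hyx : y ≠ x)
    (hd : HasDerivWithinAt u d S x) : u y < u x + d * (y - x) := by
  rcases lt_or_gt_of_ne hyx with h | h
  · have := hu.lt_slope_of_hasDerivWithinAt hy hx h hd
    rw [slope_def_field, lt_div_iff₀ (by linarith)] at this
    linarith
  · have := hu.slope_lt_of_hasDerivWithinAt hx hy h hd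
    rw [slope_def_field, div_lt_iff₀ (by linarith)] at this
    linarith

/-- Defender's best-response characterization (general payoffs): the derivative of
`τ ↦ u_d(τ, λ)` is `(C_d − ∫₀^{τ} (τ G′(τ − τ_a) − G(τ − τ_a)) f(τ_a; λ) dτ_a)/τ²`,
and depending on its sign the unique maximizer is `T`, `τ_min`, or an interior
stationary point. -/
theorem defender_best_response_general
    (τmin T lmin lmax Ca Cd : ℝ)
    (hτmin : 0 < τmin) (hτT : τmin < T)
    (hlmin : 0 ≤ lmin) (hl : lmin ≤ lmax)
    (hCa : 0 < Ca) (hCd : 0 < Cd)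
    (G G' : ℝ → ℝ)
    (hGderiv : ∀ t, HasDerivAt G (G' t) t) (hG'cont : Continuous G')
    (hGmono : Monotone G) (hGnonneg : ∀ t, 0 ≤ G t)
    (hGzeroLe : ∀ t ≤ 0, G t = 0) (hG0 : G 0 = 0)
    (f : ℝ → ℝ → ℝ)
    (hfnonneg : ∀ τa, 0 ≤ τa → ∀ l ∈ Icc lmin lmax, 0 ≤ f τa l)
    (hfpdf : ∀ l ∈ Icc lmin lmax, ∫ τa in Ioi (0:ℝ), f τa l = 1)
    (hfcont : ContinuousOn (fun p : ℝ × ℝ => f p.1 p.2) (Ici 0 ×ˢ Icc lmin lmax))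
    (l : ℝ) (hlmem : l ∈ Icc lmin lmax)
    (hudconc : StrictConcaveOn ℝ (Icc τmin T) (fun τ => uD G f Cd τ l)) :
    (∀ τ ∈ Icc τmin T,
      HasDerivWithinAt (fun x => uD G f Cd x l)
        ((Cd - ∫ τa in (0:ℝ)..τ, (τ * G' (τ - τa) - G (τ - τa)) * f τa l) / τ ^ 2)
        (Icc τmin T) τ) ∧
    ((∀ τ ∈ Icc τmin T, (∫ τa in (0:ℝ)..τ, (τ * G' (τ - τa) - G (τ - τa)) * f τa l) < Cd) →
      ∀ τ ∈ Icc τmin T, τ ≠ T → uD G f Cd τ l < uD G f Cd T l) ∧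
    ((∀ τ ∈ Icc τmin T, Cd < ∫ τa in (0:ℝ)..τ, (τ * G' (τ - τa) - G (τ - τa)) * f τa l) →
      ∀ τ ∈ Icc τmin T, τ ≠ τmin → uD G f Cd τ l < uD G f Cd τmin l) ∧
    (∀ τstar ∈ Icc τmin T,
      (∫ τa in (0:ℝ)..τstar, (τstar * G' (τstar - τa) - G (τstar - τa)) * f τa l) = Cd →
      ∀ τ ∈ Icc τmin T, τ ≠ τstar → uD G f Cd τ l < uD G f Cd τstar l) := by
  have hGc : Continuous G := continuous_iff_continuousAt.2 fun t => (hGderiv t).continuousAt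
  have hg : ContinuousOn (fun s => f s l) (Ici 0) :=
    hfcont.comp (Continuous.continuousOn (by fun_prop) : ContinuousOn (fun s : ℝ => (s, l)) (Ici 0))
      fun s hs => ⟨hs, hlmem⟩
  have hderiv : ∀ τ ∈ Icc τmin T, HasDerivWithinAt (fun x => uD G f Cd x l)
      ((Cd - ∫ τa in (0:ℝ)..τ, (τ * G' (τ - τa) - G (τ - τa)) * f τa l) / τ ^ 2)
      (Icc τmin T) τ := by
    intro τ hτ
    have hτ0 : 0 < τ := hτmin.trans_le hτ.1
    have hsplit : ∫ τa in (0:ℝ)..τ, (τ * G' (τ - τa) - G (τ - τa)) * f τa l =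
        τ * (∫ τa in (0:ℝ)..τ, G' (τ - τa) * f τa l) -
          ∫ τa in (0:ℝ)..τ, G (τ - τa) * f τa l := by
      rw [← intervalIntegral.integral_const_mul, ← intervalIntegral.integral_sub
        ((hg.intervalIntegrable_convolution hG'cont τ le_rfl hτ0.le).const_mul τ)
        (hg.intervalIntegrable_convolution hGc τ le_rfl hτ0.le)]
      congr 1
      ext s
      ring
    have hquot := ((((hasDerivAt_causal_convolution hGderiv hG'cont hGzeroLe hg hτ0).add_const
      Cd).neg).div (hasDerivAt_id τ) hτ0.ne').hasDerivWithinAt (s := Icc τmin T)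
    refine hquot.congr_deriv ?_
    rw [hsplit]
    simp only [id, Pi.neg_apply]
    ring
  refine ⟨hderiv, fun h τ hτ hne => ?_, fun h τ hτ hne => ?_, fun τstar hstar h τ hτ hne => ?_⟩
  · have hT : T ∈ Icc τmin T := right_mem_Icc.2 hτT.le
    have hlt := hudconc.lt_add_mul_sub_of_hasDerivWithinAt hT hτ hne (hderiv T hT)
    have hd := div_nonneg (sub_nonneg.2 (h T hT).le) (sq_nonneg T)
    linarith [mul_nonpos_of_nonneg_of_nonpos hd (sub_nonpos.2 hτ.2)]
  · have hm : τmin ∈ Icc τmin T := left_mem_Icc.2 hτT.le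
    have hlt := hudconc.lt_add_mul_sub_of_hasDerivWithinAt hm hτ hne (hderiv τmin hm)
    have hd := div_nonpos_of_nonpos_of_nonneg (sub_nonpos.2 (h τmin hm).le) (sq_nonneg τmin)
    linarith [mul_nonpos_of_nonpos_of_nonneg hd (sub_nonneg.2 hτ.1)]
  · have hlt := hudconc.lt_add_mul_sub_of_hasDerivWithinAt hstar hτ hne (hderiv τstar hstar)
    simpa [h] using hlt
end

section
/- If 1 − λ C_d < (1 + λ τ + λ² τ²/2) e^{−λ τ} for every (τ, λ) ∈ [τ_min, T] × [λ_min, λ_max], then the game admits a pure-strategy Nash equilibrium: there exists (τ*, λ*) ∈ [τ_min, T] × [λ_min, λ_max] such that u_d(τ*, λ*) ≥ u_d(τ, λ*) for all τ ∈ [τ_min, T] and u_a(τ*, λ*) ≥ u_a(τ*, λ) for all λ ∈ [λ_min, λ_max]. -/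
open MeasureTheory Set Real

/-- Attacker payoff in the specific instantiation `G(τ_d,τ_a) = τ_d − τ_a`,
`f(τ_a; λ) = λ e^{−λ τ_a}`: `u_a(τ_d, λ) = τ_d − ∫₀^{τ_d} e^{−λ s} ds − λ C_a`. -/
noncomputable def uaExp (Ca τd l : ℝ) : ℝ :=
  τd - (∫ s in (0:ℝ)..τd, Real.exp (-l * s)) - l * Ca

/-- Defender payoff in the specific instantiation:
`u_d(τ_d, λ) = −(τ_d − ∫₀^{τ_d} e^{−λ s} ds + C_d)/τ_d`. -/
noncomputable def udExp (Cd τd l : ℝ) : ℝ :=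
  -(τd - (∫ s in (0:ℝ)..τd, Real.exp (-l * s)) + Cd) / τd

/-- Berge's maximum theorem for a unique maximizer: it depends continuously on the parameter. -/
theorem continuous_of_unique_maximizer {X Y : Type*} [TopologicalSpace X] [TopologicalSpace Y]
    [CompactSpace Y] {f : X → Y → ℝ} (hf : Continuous fun p : X × Y => f p.1 p.2) {b : X → Y}
    (hb : ∀ x y, f x y ≤ f x (b x)) (huniq : ∀ x y, (∀ z, f x z ≤ f x y) → y = b x) :
    Continuous b := by
  have hgraph : IsClosed {p : X × Y | ∀ z, f p.1 z ≤ f p.1 p.2} := by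
    simp only [ofPred_forall]
    exact isClosed_iInter fun z => isClosed_le
      (hf.comp (continuous_fst.prodMk continuous_const)) hf
  refine continuous_iff_isClosed.2 fun C hC => ?_
  convert isClosedMap_fst_of_compactSpace _ (hgraph.inter (hC.preimage continuous_snd)) using 1
  ext x
  constructor
  · exact fun hx => ⟨(x, b x), ⟨hb x, hx⟩, rfl⟩
  · rintro ⟨⟨x', y⟩, ⟨hy, hyC⟩, rfl⟩
    exact huniq x' y hy ▸ hyC

/-- A strictly concave payoff on a compact interval, jointly continuous in a parameter, has a
continuous best-response function. -/
theorem exists_continuous_best_response {X : Type*} [TopologicalSpace X] {a b : ℝ} (hab : a ≤ b)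
    {f : X → ℝ → ℝ} (hf : Continuous fun p : X × Icc a b => f p.1 p.2)
    (hconc : ∀ x, StrictConcaveOn ℝ (Icc a b) (f x)) :
    ∃ r : X → Icc a b, Continuous r ∧ ∀ x, ∀ y ∈ Icc a b, f x y ≤ f x (r x) := by
  have : Nonempty (Icc a b) := ⟨⟨a, left_mem_Icc.2 hab⟩⟩
  have hex : ∀ x, ∃ y : Icc a b, ∀ z : Icc a b, f x z ≤ f x y := fun x => by
    have hc : Continuous fun y : Icc a b => f x y :=
      hf.comp (continuous_const.prodMk continuous_id)
    obtain ⟨y, -, hy⟩ := isCompact_univ.exists_isMaxOn univ_nonempty hc.continuousOn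
    exact ⟨y, fun z => hy (mem_univ z)⟩
  choose r hr using hex
  refine ⟨r, continuous_of_unique_maximizer (f := fun x (y : Icc a b) => f x y) hf hr
    fun x y hy => Subtype.ext ?_, fun x y hy => hr x ⟨y, hy⟩⟩
  exact (hconc x).eq_of_isMaxOn (fun z hz => hy ⟨z, hz⟩) (fun z hz => hr x ⟨z, hz⟩)
    y.2 (r x).2

/-- A two-player game on compact intervals with continuous payoffs, each strictly concave in the
player's own action, has a pure-strategy Nash equilibrium. -/
theorem exists_nash_of_strictConcaveOn {a b c d : ℝ} (hab : a ≤ b) (hcd : c ≤ d)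
    {u v : ℝ → ℝ → ℝ}
    (hu : ContinuousOn (fun p : ℝ × ℝ => u p.1 p.2) (Icc a b ×ˢ Icc c d))
    (hv : ContinuousOn (fun p : ℝ × ℝ => v p.1 p.2) (Icc a b ×ˢ Icc c d))
    (hu' : ∀ y ∈ Icc c d, StrictConcaveOn ℝ (Icc a b) fun x => u x y)
    (hv' : ∀ x ∈ Icc a b, StrictConcaveOn ℝ (Icc c d) (v x)) :
    ∃ x ∈ Icc a b, ∃ y ∈ Icc c d,
      (∀ x' ∈ Icc a b, u x' y ≤ u x y) ∧ ∀ y' ∈ Icc c d, v x y' ≤ v x y := by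
  obtain ⟨r, hrc, hr⟩ := exists_continuous_best_response (X := Icc c d) hab
    (f := fun y x => u x y)
    (hu.comp_continuous (f := fun p : Icc c d × Icc a b => ((p.2 : ℝ), (p.1 : ℝ)))
      (by fun_prop) fun p => ⟨p.2.2, p.1.2⟩) fun y => hu' y y.2
  obtain ⟨s, hsc, hs⟩ := exists_continuous_best_response (X := Icc a b) hcd
    (f := fun x y => v x y)
    (hv.comp_continuous (f := fun p : Icc a b × Icc c d => ((p.1 : ℝ), (p.2 : ℝ)))
      (by fun_prop) fun p => ⟨p.1.2, p.2.2⟩) fun x => hv' x x.2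
  have hg : Continuous fun x => ((r (s (projIcc a b hab x)) : Icc a b) : ℝ) :=
    continuous_subtype_val.comp (hrc.comp (hsc.comp continuous_projIcc))
  obtain ⟨x, hx, hfix⟩ := exists_mem_Icc_isFixedPt_of_mapsTo hg.continuousOn hab
    fun x _ => (r (s (projIcc a b hab x))).2
  rw [Function.IsFixedPt, projIcc_of_mem hab hx] at hfix
  refine ⟨x, hx, s ⟨x, hx⟩, (s ⟨x, hx⟩).2, fun x' hx' => ?_, hs ⟨x, hx⟩⟩
  have := hr (s ⟨x, hx⟩) x' hx'
  rwa [hfix] at this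

theorem continuous_integral_exp_neg_mul :
    Continuous fun p : ℝ × ℝ => ∫ s in (0:ℝ)..p.1, Real.exp (-p.2 * s) :=
  intervalIntegral.continuous_parametric_intervalIntegral_of_continuous
    (f := fun (p : ℝ × ℝ) s => Real.exp (-p.2 * s)) (by fun_prop) continuous_fst

theorem integral_exp_neg_mul {l : ℝ} (hl : l ≠ 0) (τ : ℝ) :
    ∫ s in (0:ℝ)..τ, Real.exp (-l * s) = (1 - Real.exp (-l * τ)) / l := by
  rw [intervalIntegral.integral_comp_mul_left _ (neg_ne_zero.2 hl), integral_exp]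
  simp only [mul_zero, Real.exp_zero, smul_eq_mul]
  field_simp
  ring

theorem strictConvexOn_integral_exp_neg_mul {τ : ℝ} (hτ : 0 < τ) :
    StrictConvexOn ℝ univ fun l : ℝ => ∫ s in (0:ℝ)..τ, Real.exp (-l * s) := by
  refine ⟨convex_univ, fun x _ y _ hxy a b ha hb hab => ?_⟩
  have hint : ∀ l : ℝ, IntervalIntegrable (fun s => Real.exp (-l * s)) volume 0 τ := fun l =>
    Continuous.intervalIntegrable (by fun_prop) _ _
  have harg : ∀ s : ℝ, -(a • x + b • y) * s = a • (-x * s) + b • (-y * s) := fun s => by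
    simp only [smul_eq_mul]; ring
  simp only [smul_eq_mul, ← intervalIntegral.integral_const_mul]
  rw [← intervalIntegral.integral_add ((hint x).const_mul a) ((hint y).const_mul b)]
  refine intervalIntegral.integral_lt_integral_of_continuousOn_of_le_of_exists_lt hτ
    (by fun_prop) (by fun_prop) (fun s _ => ?_) ⟨τ, right_mem_Icc.2 hτ.le, ?_⟩
  · have := convexOn_exp.2 (mem_univ (-x * s)) (mem_univ (-y * s)) ha.le hb.le hab
    rwa [← harg] at this
  · have hne : -x * τ ≠ -y * τ := fun h => hxy (neg_injective (mul_right_cancel₀ hτ.ne' h))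
    have := strictConvexOn_exp.2 (mem_univ (-x * τ)) (mem_univ (-y * τ)) hne ha hb hab
    rwa [← harg] at this

theorem strictConcaveOn_uaExp (Ca : ℝ) {τ : ℝ} (hτ : 0 < τ) :
    StrictConcaveOn ℝ univ (uaExp Ca τ) := by
  refine ⟨convex_univ, fun x hx y hy hxy a b ha hb hab => ?_⟩
  have h := (strictConvexOn_integral_exp_neg_mul hτ).2 hx hy hxy ha hb hab
  simp only [uaExp, smul_eq_mul] at h ⊢
  have hτ' : a * τ + b * τ = τ := by rw [← add_mul, hab, one_mul]
  linarith

theorem continuous_uaExp (Ca : ℝ) : Continuous fun p : ℝ × ℝ => uaExp Ca p.1 p.2 :=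
  (continuous_fst.sub continuous_integral_exp_neg_mul).sub (continuous_snd.mul continuous_const)

theorem continuousOn_udExp (Cd : ℝ) {s : Set (ℝ × ℝ)} (hs : ∀ p ∈ s, p.1 ≠ 0) :
    ContinuousOn (fun p : ℝ × ℝ => udExp Cd p.1 p.2) s :=
  ((continuous_fst.sub continuous_integral_exp_neg_mul).add
    continuous_const).neg.continuousOn.div continuousOn_fst hs

theorem hasDerivAt_integral_exp_neg_mul (l τ : ℝ) :
    HasDerivAt (fun t => ∫ s in (0:ℝ)..t, Real.exp (-l * s)) (Real.exp (-l * τ)) τ :=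
  have h : Continuous fun s : ℝ => Real.exp (-l * s) := by fun_prop
  (h.integral_hasStrictDerivAt 0 τ).hasDerivAt

theorem hasDerivAt_udExp (Cd l : ℝ) {τ : ℝ} (hτ : τ ≠ 0) :
    HasDerivAt (fun t => udExp Cd t l)
      ((τ * Real.exp (-l * τ) - (∫ s in (0:ℝ)..τ, Real.exp (-l * s)) + Cd) / τ ^ 2) τ := by
  have h := ((((hasDerivAt_id τ).sub (hasDerivAt_integral_exp_neg_mul l τ)).add_const
    Cd).neg.div (hasDerivAt_id τ) hτ)
  refine h.congr_deriv ?_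
  simp
  ring

theorem deriv2_udExp (Cd l : ℝ) {τ : ℝ} (hτ : τ ≠ 0) :
    deriv^[2] (fun t => udExp Cd t l) τ =
      (-(l * τ ^ 2 * Real.exp (-l * τ)) - 2 * (τ * Real.exp (-l * τ) -
        (∫ s in (0:ℝ)..τ, Real.exp (-l * s)) + Cd)) / τ ^ 3 := by
  have hev : deriv (fun t => udExp Cd t l) =ᶠ[nhds τ] fun t =>
      (t * Real.exp (-l * t) - (∫ s in (0:ℝ)..t, Real.exp (-l * s)) + Cd) / t ^ 2 := by
    filter_upwards [isOpen_ne.mem_nhds hτ] with t ht using (hasDerivAt_udExp Cd l ht).deriv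
  have hexp : HasDerivAt (fun t => Real.exp (-l * t)) (Real.exp (-l * τ) * (-l * 1)) τ :=
    ((hasDerivAt_id τ).const_mul (-l)).exp
  have h := ((((hasDerivAt_id τ).mul hexp).sub (hasDerivAt_integral_exp_neg_mul l τ)).add_const
    Cd).div (hasDerivAt_pow 2 τ) (pow_ne_zero 2 hτ)
  rw [Function.iterate_succ_apply, Function.iterate_one, hev.deriv_eq]
  refine h.deriv.trans ?_
  simp
  field_simp

theorem strictConcaveOn_udExp {Cd l a b : ℝ} (ha : 0 < a) (hl : 0 < l)
    (hcond : ∀ τ ∈ Icc a b,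
      1 - l * Cd < (1 + l * τ + l ^ 2 * τ ^ 2 / 2) * Real.exp (-l * τ)) :
    StrictConcaveOn ℝ (Icc a b) fun τ => udExp Cd τ l := by
  have hpos : ∀ τ ∈ Icc a b, 0 < τ := fun τ hτ => ha.trans_le hτ.1
  refine strictConcaveOn_of_deriv2_neg' (convex_Icc a b)
    (fun τ hτ => (hasDerivAt_udExp Cd l (hpos τ hτ).ne').continuousAt.continuousWithinAt)
    fun τ hτ => ?_
  rw [deriv2_udExp Cd l (hpos τ hτ).ne', integral_exp_neg_mul hl.ne']
  refine div_neg_of_neg_of_pos ?_ (pow_pos (hpos τ hτ) 3)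
  have hfactor : -(l * τ ^ 2 * Real.exp (-l * τ)) - 2 * (τ * Real.exp (-l * τ) -
      (1 - Real.exp (-l * τ)) / l + Cd) =
      2 / l * (1 - l * Cd - (1 + l * τ + l ^ 2 * τ ^ 2 / 2) * Real.exp (-l * τ)) := by
    field_simp
    ring
  rw [hfactor]
  exact mul_neg_of_pos_of_neg (by positivity) (sub_neg.2 (hcond τ hτ))

/-- Theorem 5 (specific instantiation): if
`1 − λ C_d < (1 + λ τ + λ² τ²/2) e^{−λ τ}` on the whole action space, the game admits a
pure-strategy Nash equilibrium. -/
theorem nash_existence_specific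
    (τmin T lmin lmax Ca Cd : ℝ)
    (hτmin : 0 < τmin) (hτT : τmin ≤ T)
    (hlmin : 0 ≤ lmin) (hl : lmin ≤ lmax)
    (hCa : 0 < Ca) (hCd : 0 < Cd)
    (hcond : ∀ τ ∈ Icc τmin T, ∀ l ∈ Icc lmin lmax,
      1 - l * Cd < (1 + l * τ + l ^ 2 * τ ^ 2 / 2) * Real.exp (-l * τ)) :
    ∃ τstar ∈ Icc τmin T, ∃ lstar ∈ Icc lmin lmax,
      (∀ τ ∈ Icc τmin T, udExp Cd τ lstar ≤ udExp Cd τstar lstar) ∧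
      (∀ l ∈ Icc lmin lmax, uaExp Ca τstar l ≤ uaExp Ca τstar lstar) := by
  have hlpos : 0 < lmin := hlmin.lt_of_ne fun h => by
    simpa [← h] using hcond τmin (left_mem_Icc.2 hτT) lmin (left_mem_Icc.2 hl)
  exact exists_nash_of_strictConcaveOn hτT hl
    (continuousOn_udExp Cd fun p hp => (hτmin.trans_le hp.1.1).ne')
    (continuous_uaExp Ca).continuousOn
    (fun l h => strictConcaveOn_udExp hτmin (hlpos.trans_le h.1) fun τ hτ => hcond τ hτ l h)
    fun τ hτ => (strictConcaveOn_uaExp Ca (hτmin.trans_le hτ.1)).subset (subset_univ _)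
      (convex_Icc _ _)
end

section
/- Fix τ_d ∈ [τ_min, T] with τ_d > 0 and suppose 0 < λ_min < λ_max, and let D(λ) = e^{−λ τ_d}((1 − C_a λ²) e^{λ τ_d} − λ τ_d − 1). Then the attacker's best response to τ_d is characterized as follows: (i) if D(λ) > 0 for all λ ∈ [λ_min, λ_max], then λ_max is the unique maximizer of λ ↦ u_a(τ_d, λ) over [λ_min, λ_max]; (ii) if D(λ) < 0 for all λ ∈ [λ_min, λ_max], then λ_min is the unique maximizer; (iii) if λ* ∈ [λ_min, λ_max] satisfies D(λ*) = 0, then λ* is the unique maximizer. -/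
open MeasureTheory Set Real

/-- The first moment of the unnormalized exponential density on `[0, t]`. -/
lemma integral_mul_exp_neg_mul {m : ℝ} (hm : m ≠ 0) (t : ℝ) :
    ∫ s in (0:ℝ)..t, s * exp (-m * s) = (1 - exp (-m * t) * (1 + m * t)) / m ^ 2 := by
  have hderiv : ∀ x ∈ uIcc 0 t,
      HasDerivAt (fun s => -(exp (-m * s) * (1 + m * s)) / m ^ 2) (x * exp (-m * x)) x := by
    intro x _
    have h₁ : HasDerivAt (fun s => exp (-m * s)) (exp (-m * x) * (-m)) x := by
      simpa using ((hasDerivAt_id x).const_mul (-m)).exp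
    have h₂ : HasDerivAt (fun s => 1 + m * s) m x := by
      simpa using ((hasDerivAt_id x).const_mul m).const_add 1
    refine ((h₁.mul h₂).neg.div_const (m ^ 2)).congr_deriv ?_
    field_simp
    ring
  rw [intervalIntegral.integral_eq_sub_of_hasDerivAt hderiv
    ((by fun_prop : Continuous fun s => s * exp (-m * s)).intervalIntegrable _ _)]
  simp
  ring

/-- Strict concavity of the attacker's payoff in the rate, in tangent-line form. -/
lemma uaExp_lt_tangent (Ca : ℝ) {t l m : ℝ} (ht : 0 < t) (hm : m ≠ 0) (hlm : l ≠ m) :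
    uaExp Ca t l < uaExp Ca t m + (l - m) *
      (exp (-m * t) * ((1 - Ca * m ^ 2) * exp (m * t) - m * t - 1) / m ^ 2) := by
  have hint : ∀ f : ℝ → ℝ, Continuous f → IntervalIntegrable f volume 0 t :=
    fun f hf => hf.intervalIntegrable _ _
  have hpos : 0 < ∫ s in (0:ℝ)..t,
      (exp (-l * s) - exp (-m * s) + (l - m) * (s * exp (-m * s))) := by
    refine intervalIntegral.intervalIntegral_pos_of_pos_on (hint _ (by fun_prop)) ?_ ht
    intro s hs
    have hne : (m - l) * s ≠ 0 := mul_ne_zero (sub_ne_zero.2 hlm.symm) hs.1.ne'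
    have hexp : exp (-l * s) = exp (-m * s) * exp ((m - l) * s) := by
      rw [← exp_add]
      ring_nf
    rw [hexp]
    nlinarith [mul_pos (exp_pos (-m * s)) (sub_pos.2 (add_one_lt_exp hne))]
  rw [intervalIntegral.integral_add (hint _ (by fun_prop)) (hint _ (by fun_prop)),
    intervalIntegral.integral_sub (hint _ (by fun_prop)) (hint _ (by fun_prop)),
    intervalIntegral.integral_const_mul, integral_mul_exp_neg_mul hm] at hpos
  have hslope : exp (-m * t) * ((1 - Ca * m ^ 2) * exp (m * t) - m * t - 1) / m ^ 2 =
      (1 - exp (-m * t) * (1 + m * t)) / m ^ 2 - Ca := by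
    have hinv : exp (-m * t) * exp (m * t) = 1 := by
      rw [← exp_add]
      simp
    rw [div_sub' (pow_ne_zero 2 hm)]
    congr 1
    linear_combination (1 - Ca * m ^ 2) * hinv
  rw [hslope, uaExp, uaExp]
  linarith

/-- Lemma (attacker's best response, specific instantiation): with
`D(λ) = e^{−λ τ_d}((1 − C_a λ²) e^{λ τ_d} − λ τ_d − 1)`, the unique maximizer of
`λ ↦ u_a(τ_d, λ)` on `[λ_min, λ_max]` is `λ_max` if `D > 0` everywhere, `λ_min` if
`D < 0` everywhere, and any zero of `D` in `[λ_min, λ_max]`. -/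
theorem attacker_best_response_specific
    (τmin T lmin lmax Ca : ℝ)
    (hτmin : 0 < τmin) (hτT : τmin ≤ T)
    (hlmin : 0 < lmin) (hl : lmin < lmax)
    (hCa : 0 < Ca)
    (τd : ℝ) (hτd : τd ∈ Icc τmin T) (hτdpos : 0 < τd)
    (D : ℝ → ℝ)
    (hD : D = fun l => Real.exp (-l * τd) *
      ((1 - Ca * l ^ 2) * Real.exp (l * τd) - l * τd - 1)) :
    ((∀ l ∈ Icc lmin lmax, 0 < D l) →
      ∀ l ∈ Icc lmin lmax, l ≠ lmax → uaExp Ca τd l < uaExp Ca τd lmax) ∧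
    ((∀ l ∈ Icc lmin lmax, D l < 0) →
      ∀ l ∈ Icc lmin lmax, l ≠ lmin → uaExp Ca τd l < uaExp Ca τd lmin) ∧
    (∀ lstar ∈ Icc lmin lmax, D lstar = 0 →
      ∀ l ∈ Icc lmin lmax, l ≠ lstar → uaExp Ca τd l < uaExp Ca τd lstar) := by
  have key : ∀ m ∈ Icc lmin lmax, ∀ l, l ≠ m →
      uaExp Ca τd l < uaExp Ca τd m + (l - m) * (D m / m ^ 2) := by
    intro m hm l hlm
    rw [hD]
    exact uaExp_lt_tangent Ca hτdpos (hlmin.trans_le hm.1).ne' hlm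
  refine ⟨fun h l hlI hne => ?_, fun h l hlI hne => ?_, fun m hm h l _ hne => ?_⟩
  · have hmem := right_mem_Icc.2 hl.le
    have hslope : (l - lmax) * (D lmax / lmax ^ 2) ≤ 0 :=
      mul_nonpos_of_nonpos_of_nonneg (sub_nonpos.2 hlI.2)
        (div_nonneg (h _ hmem).le (sq_nonneg _))
    linarith [key _ hmem l hne]
  · have hmem := left_mem_Icc.2 hl.le
    have hslope : (l - lmin) * (D lmin / lmin ^ 2) ≤ 0 :=
      mul_nonpos_of_nonneg_of_nonpos (sub_nonneg.2 hlI.1)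
        (div_nonpos_of_nonpos_of_nonneg (h _ hmem).le (sq_nonneg _))
    linarith [key _ hmem l hne]
  · simpa [h] using key m hm l hne
end

section
/- Fix τ_d ∈ [τ_min, T] with τ_d > 0 and suppose 0 < λ_min < λ_max. If C_a > (1 − (1 + λ_max τ_d) e^{−λ_max τ_d})/λ_min², then the attacker's best response to τ_d is λ_min: u_a(τ_d, λ_min) > u_a(τ_d, λ) for every λ ∈ (λ_min, λ_max]. -/
open MeasureTheory Set Real

theorem uaExp_of_ne_zero (Ca τd : ℝ) {l : ℝ} (hl : l ≠ 0) :
    uaExp Ca τd l = τd - (1 - Real.exp (-l * τd)) / l - l * Ca := by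
  have h : (∫ s in (0:ℝ)..τd, Real.exp (-l * s)) = (1 - Real.exp (-l * τd)) / l := by
    rw [intervalIntegral.integral_comp_mul_left (fun x => Real.exp x) (neg_ne_zero.mpr hl),
      integral_exp, smul_eq_mul, mul_zero, Real.exp_zero]
    field_simp
    ring
  rw [uaExp, h]

theorem one_add_mul_exp_neg_antitoneOn :
    AntitoneOn (fun x : ℝ => (1 + x) * Real.exp (-x)) (Ici 0) := by
  intro x hx y _ hxy
  have hx : 0 ≤ x := hx
  have hexp : Real.exp (-x) = Real.exp (y - x) * Real.exp (-y) := by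
    rw [← Real.exp_add]
    ring_nf
  have h : 1 + y ≤ (1 + x) * Real.exp (y - x) := by
    have := mul_le_mul_of_nonneg_left (Real.add_one_le_exp (y - x)) (by linarith : 0 ≤ 1 + x)
    nlinarith [mul_nonneg hx (sub_nonneg.mpr hxy)]
  calc (1 + y) * Real.exp (-y) ≤ ((1 + x) * Real.exp (y - x)) * Real.exp (-y) := by gcongr
    _ = (1 + x) * Real.exp (-x) := by rw [hexp, mul_assoc]

theorem hasDerivAt_one_sub_exp_neg_mul_div (t : ℝ) {x : ℝ} (hx : x ≠ 0) :
    HasDerivAt (fun l : ℝ => (1 - Real.exp (-l * t)) / l)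
      (-((1 - (1 + x * t) * Real.exp (-x * t)) / x ^ 2)) x := by
  have h := ((((hasDerivAt_id x).neg.mul_const t).exp.const_sub 1).div (hasDerivAt_id x) hx)
  refine h.congr_deriv ?_
  simp only [id, Pi.neg_apply]
  ring

/-- Theorem (attacker cost bound, specific instantiation): if
`C_a > (1 − (1 + λ_max τ_d) e^{−λ_max τ_d})/λ_min²`, then the attacker's best response
to `τ_d` is `λ_min`. -/
theorem attacker_cost_bound_specific
    (τmin T lmin lmax Ca : ℝ)
    (hτmin : 0 < τmin) (hτT : τmin ≤ T)
    (hlmin : 0 < lmin) (hl : lmin < lmax)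
    (τd : ℝ) (hτd : τd ∈ Icc τmin T) (hτdpos : 0 < τd)
    (hCa : (1 - (1 + lmax * τd) * Real.exp (-lmax * τd)) / lmin ^ 2 < Ca) :
    ∀ l ∈ Ioc lmin lmax, uaExp Ca τd l < uaExp Ca τd lmin := by
  intro l ⟨hl₁, hl₂⟩
  obtain ⟨c, ⟨hc₁, hc₂⟩, hc⟩ := exists_hasDerivAt_eq_slope
    (fun l : ℝ => (1 - Real.exp (-l * τd)) / l) _ hl₁
    (fun x hx => (hasDerivAt_one_sub_exp_neg_mul_div τd
      (hlmin.trans_le hx.1).ne').continuousAt.continuousWithinAt)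
    (fun x hx => hasDerivAt_one_sub_exp_neg_mul_div τd (hlmin.trans hx.1).ne')
  have hc0 : 0 < c := hlmin.trans hc₁
  have hcτ : 0 ≤ c * τd := by positivity
  have hcmax : c * τd ≤ lmax * τd := by
    gcongr
    exact hc₂.le.trans hl₂
  have hmono := one_add_mul_exp_neg_antitoneOn (mem_Ici.mpr hcτ)
    (mem_Ici.mpr (hcτ.trans hcmax)) hcmax
  have hnonneg := one_add_mul_exp_neg_antitoneOn (mem_Ici.mpr le_rfl)
    (mem_Ici.mpr (hcτ.trans hcmax)) (hcτ.trans hcmax)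
  simp only [← neg_mul, add_zero, neg_zero, Real.exp_zero, mul_one] at hmono hnonneg
  have hbound : (1 - (1 + c * τd) * Real.exp (-c * τd)) / c ^ 2 < Ca := by
    refine lt_of_le_of_lt ?_ hCa
    gcongr
  rw [eq_div_iff (sub_pos.mpr hl₁).ne'] at hc
  rw [uaExp_of_ne_zero _ _ (hlmin.trans hl₁).ne', uaExp_of_ne_zero _ _ hlmin.ne']
  linarith [mul_lt_mul_of_pos_right hbound (sub_pos.mpr hl₁)]
end
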